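/- The time-changed Brownian motion M = (W_{Λ_t})_{t ∈ [0,T]} is a martingale with respect to the time-changed enlarged filtration Ĥ: M is Ĥ-adapted, each M_t is integrable, and E[M_t | Ĥ_s] = M_s almost surely for all 0 ≤ s ≤ t ≤ T. -/

import Mathlib

open MeasureTheory ProbabilityTheory

noncomputable section

/-- The σ-algebra generated by the `P`-null sets. -/
def nullSA {Ω : Type*} [MeasurableSpace Ω] (P : Measure Ω) : MeasurableSpace Ω :=
  MeasurableSpace.generateFrom {s : Set Ω | P s = 0}

/-- The `P`-augmented natural σ-algebra generated by a real-valued process up to time `r`: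
`σ(X_u, 0 ≤ u ≤ r) ∨ N`. -/
def natSA {Ω : Type*} [MeasurableSpace Ω] (P : Measure Ω) (X : ℝ → Ω → ℝ) (r : ℝ) :
    MeasurableSpace Ω :=
  (⨆ u ∈ Set.Icc (0 : ℝ) r, MeasurableSpace.comap (X u) inferInstance) ⊔ nullSA P

/-- A standard Brownian motion on `[0,R]` under `PW`: jointly measurable, starting at `0`,
with continuous paths, increments independent of the past, and Gaussian increments. -/
structure IsBrownian {ΩW : Type*} [MeasurableSpace ΩW] (PW : Measure ΩW) (R : ℝ)
    (W : ℝ → ΩW → ℝ) : Prop where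
  measurable : Measurable (Function.uncurry W)
  start : ∀ ω, W 0 ω = 0
  cont : ∀ ω, ContinuousOn (fun r => W r ω) (Set.Icc 0 R)
  indep_incr : ∀ s t : ℝ, 0 ≤ s → s ≤ t → t ≤ R →
    Indep (MeasurableSpace.comap (fun ω => W t ω - W s ω) inferInstance)
      (⨆ u ∈ Set.Icc (0 : ℝ) s, MeasurableSpace.comap (W u) inferInstance) PW
  gauss_incr : ∀ s t : ℝ, 0 ≤ s → s ≤ t → t ≤ R →
    PW.map (fun ω => W t ω - W s ω) = gaussianReal 0 (Real.toNNReal (t - s))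

/-- A time change on `[0,T]`: measurable, nondecreasing, right-continuous, starting at `0`,
with values in `[0,R]`. -/
structure IsTimeChange {ΩΛ : Type*} [MeasurableSpace ΩΛ] (T R : ℝ) (Lam : ℝ → ΩΛ → ℝ) :
    Prop where
  measurable : ∀ t, Measurable (Lam t)
  mono : ∀ ω, MonotoneOn (fun t => Lam t ω) (Set.Icc 0 T)
  right_cont : ∀ ω, ∀ t ∈ Set.Ico 0 T, ContinuousWithinAt (fun s => Lam s ω) (Set.Ici t) t
  start : ∀ ω, Lam 0 ω = 0
  mem : ∀ ω, ∀ t ∈ Set.Icc 0 T, Lam t ω ∈ Set.Icc 0 R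

variable {ΩΛ ΩW : Type*} [mΛ : MeasurableSpace ΩΛ] [mW : MeasurableSpace ΩW]

/-- The Brownian motion lifted to the product space: `W_r(ω_Λ, ω_W) = W_r(ω_W)`. -/
def liftW (W : ℝ → ΩW → ℝ) (r : ℝ) : ΩΛ × ΩW → ℝ := fun ω => W r ω.2

/-- The time change lifted to the product space: `Λ_t(ω_Λ, ω_W) = Λ_t(ω_Λ)`. -/
def liftLam (Lam : ℝ → ΩΛ → ℝ) (t : ℝ) : ΩΛ × ΩW → ℝ := fun ω => Lam t ω.1

/-- The time-changed Brownian motion `M_t = W_{Λ_t}`. -/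
def tcBM (W : ℝ → ΩW → ℝ) (Lam : ℝ → ΩΛ → ℝ) (t : ℝ) : ΩΛ × ΩW → ℝ :=
  fun ω => W (Lam t ω.1) ω.2

/-- The filtration `F`: `F_t = ⋂_{s > t} (F^M_s ∨ F^Λ_s)` for `t < T`, and
`F_T = F^M_T ∨ F^Λ_T`. -/
def Ffilt (P : Measure (ΩΛ × ΩW)) (W : ℝ → ΩW → ℝ) (Lam : ℝ → ΩΛ → ℝ) (T t : ℝ) :
    MeasurableSpace (ΩΛ × ΩW) :=
  if t < T then ⨅ s ∈ Set.Ioc t T, (natSA P (tcBM W Lam) s ⊔ natSA P (liftLam Lam) s)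
  else natSA P (tcBM W Lam) T ⊔ natSA P (liftLam Lam) T

/-- The initially enlarged filtration `H_r = F^W_r ∨ F^Λ_T`. -/
def Hfilt (P : Measure (ΩΛ × ΩW)) (W : ℝ → ΩW → ℝ) (Lam : ℝ → ΩΛ → ℝ) (T r : ℝ) :
    MeasurableSpace (ΩΛ × ΩW) :=
  natSA P (liftW W) r ⊔ natSA P (liftLam Lam) T

/-- The time-changed enlarged filtration
`Ĥ_t = H_{Λ_t} = {A ∈ H_R : A ∩ {Λ_t ≤ r} ∈ H_r for all r ∈ [0,R]}`. -/
def HhatSA (P : Measure (ΩΛ × ΩW)) (W : ℝ → ΩW → ℝ) (Lam : ℝ → ΩΛ → ℝ) (T R t : ℝ) :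
    MeasurableSpace (ΩΛ × ΩW) :=
  MeasurableSpace.generateFrom
    {A | MeasurableSet[Hfilt P W Lam T R] A ∧
      ∀ r ∈ Set.Icc (0 : ℝ) R, MeasurableSet[Hfilt P W Lam T r] (A ∩ {ω | Lam t ω.1 ≤ r})}

/-- The generalised inverse (first-hitting-time process) of the time change:
`Γ_r = inf {t ∈ [0,T] : Λ_t > r}` for `r < Λ_T`, and `Γ_r = T` otherwise. -/
def genInvP (T : ℝ) {ΩΛ : Type*} (Lam : ℝ → ΩΛ → ℝ) (r : ℝ) (ωΛ : ΩΛ) : ℝ :=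
  if r < Lam T ωΛ then sInf {t ∈ Set.Icc 0 T | r < Lam t ωΛ} else T

/-- History σ-algebra of `W` on its own space. -/
def histSA {ΩW : Type*} (W : ℝ → ΩW → ℝ) (r : ℝ) : MeasurableSpace ΩW :=
  ⨆ u ∈ Set.Icc (0 : ℝ) r, MeasurableSpace.comap (W u) inferInstance

theorem bm_meas {PW : Measure ΩW} {R : ℝ} {W : ℝ → ΩW → ℝ} (hW : IsBrownian PW R W) (r : ℝ) :
    Measurable (W r) :=
  hW.measurable.comp measurable_prodMk_left

theorem histSA_le {PW : Measure ΩW} {R : ℝ} {W : ℝ → ΩW → ℝ} (hW : IsBrownian PW R W) (r : ℝ) :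
    histSA W r ≤ mW :=
  iSup₂_le fun u _ => (bm_meas hW u).comap_le

theorem bm_incr_memLp {PW : Measure ΩW} [IsProbabilityMeasure PW] {R : ℝ} {W : ℝ → ΩW → ℝ}
    (hW : IsBrownian PW R W) {s t : ℝ} (hs : 0 ≤ s) (hst : s ≤ t) (ht : t ≤ R) :
    MemLp (fun ω => W t ω - W s ω) 2 PW := by
  have hm : Measurable (fun ω => W t ω - W s ω) := (bm_meas hW t).sub (bm_meas hW s)
  have h : MemLp id 2 (PW.map (fun ω => W t ω - W s ω)) := by
    rw [hW.gauss_incr s t hs hst ht]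
    exact memLp_id_gaussianReal 2
  exact (memLp_map_measure_iff h.1 hm.aemeasurable).1 h

theorem bm_incr_integral {PW : Measure ΩW} [IsProbabilityMeasure PW] {R : ℝ} {W : ℝ → ΩW → ℝ}
    (hW : IsBrownian PW R W) {s t : ℝ} (hs : 0 ≤ s) (hst : s ≤ t) (ht : t ≤ R) :
    ∫ ω, (W t ω - W s ω) ∂PW = 0 := by
  have hm : Measurable (fun ω => W t ω - W s ω) := (bm_meas hW t).sub (bm_meas hW s)
  have h := integral_map (μ := PW) hm.aemeasurable (f := fun x : ℝ => x)
    (by fun_prop)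
  rw [← h, hW.gauss_incr s t hs hst ht, integral_id_gaussianReal]

theorem bm_incr_abs {PW : Measure ΩW} [IsProbabilityMeasure PW] {R : ℝ} {W : ℝ → ΩW → ℝ}
    (hW : IsBrownian PW R W) {s t : ℝ} (hs : 0 ≤ s) (hst : s ≤ t) (ht : t ≤ R) :
    ∫ ω, |W t ω - W s ω| ∂PW ≤ √(t - s) := by
  have hm : Measurable (fun ω => W t ω - W s ω) := (bm_meas hW t).sub (bm_meas hW s)
  have hL := bm_incr_memLp hW hs hst ht
  have h0 := bm_incr_integral hW hs hst ht
  have hv : Var[fun ω => W t ω - W s ω; PW] = t - s := by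
    have := variance_map (X := id) (Y := fun ω => W t ω - W s ω) (μ := PW) (by fun_prop)
      hm.aemeasurable
    rw [hW.gauss_incr s t hs hst ht, variance_id_gaussianReal] at this
    rw [Real.coe_toNNReal _ (by linarith)] at this
    exact this.symm
  rw [variance_eq_sub hL, h0] at hv
  have h2 := variance_nonneg (fun ω => |W t ω - W s ω|) PW
  have hL' : MemLp (fun ω => |W t ω - W s ω|) 2 PW := hL.norm
  rw [variance_eq_sub hL'] at h2
  apply Real.le_sqrt_of_sq_le
  simp only [Pi.pow_apply, sq_abs] at h2 hv
  linarith

theorem bm_incr_set {PW : Measure ΩW} [IsProbabilityMeasure PW] {R : ℝ} {W : ℝ → ΩW → ℝ}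
    (hW : IsBrownian PW R W) {s t : ℝ} (hs : 0 ≤ s) (hst : s ≤ t) (ht : t ≤ R) {S : Set ΩW}
    (hS : MeasurableSet[eventuallyMeasurableSpace (histSA W s) (ae PW)] S) :
    ∫ ω in S, (W t ω - W s ω) ∂PW = 0 := by
  have hm : Measurable (fun ω => W t ω - W s ω) := (bm_meas hW t).sub (bm_meas hW s)
  obtain ⟨S0, hS0, hSS⟩ := hS
  rw [setIntegral_congr_set hSS]
  have hint := (bm_incr_memLp hW hs hst ht).integrable (by norm_num)
  have h1 := condExp_indep_eq (m₁ := MeasurableSpace.comap (fun ω => W t ω - W s ω) inferInstance)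
    (f := fun ω => W t ω - W s ω) hm.comap_le (histSA_le hW s)
    (comap_measurable _).stronglyMeasurable (hW.indep_incr s t hs hst ht)
  rw [← setIntegral_condExp (histSA_le hW s) hint hS0]
  rw [bm_incr_integral hW hs hst ht] at h1
  rw [setIntegral_congr_ae (g := fun _ => (0 : ℝ)) (histSA_le hW s _ hS0)
    (h1.mono fun x hx _ => hx)]
  simp

theorem bm_incr_set' {PW : Measure ΩW} [IsProbabilityMeasure PW] {R : ℝ} {W : ℝ → ΩW → ℝ}
    (hW : IsBrownian PW R W) {s t : ℝ} (hs : 0 ≤ s) (hst : s ≤ t) (ht : t ≤ R) {S : Set ΩW}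
    (hS : ∀ r : ℚ, (r : ℝ) ∈ Set.Icc 0 R → s ≤ r →
      MeasurableSet[eventuallyMeasurableSpace (histSA W r) (ae PW)] S) :
    ∫ ω in S, (W t ω - W s ω) ∂PW = 0 := by
  rcases hst.eq_or_lt with rfl | hlt
  · simp
  have key : ∀ ε > 0, |∫ ω in S, (W t ω - W s ω) ∂PW| ≤ ε := by
    intro ε hε
    obtain ⟨r, hr1, hr2⟩ := exists_rat_btwn (show s < min t (s + ε ^ 2) from
      lt_min hlt (by nlinarith [sq_pos_of_pos hε]))
    have hrt : (r : ℝ) ≤ t := hr2.le.trans (min_le_left _ _)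
    have hre : (r : ℝ) - s ≤ ε ^ 2 := by linarith [hr2.le.trans (min_le_right _ _)]
    have h1 := bm_incr_set hW (hs.trans hr1.le) hrt ht
      (hS r ⟨hs.trans hr1.le, hrt.trans ht⟩ hr1.le)
    have i1 := (bm_incr_memLp hW (hs.trans hr1.le) hrt ht).integrable (by norm_num)
    have i2 := (bm_incr_memLp hW hs hr1.le (hrt.trans ht)).integrable (by norm_num)
    have e : ∫ ω in S, (W t ω - W s ω) ∂PW
        = ∫ ω in S, (W t ω - W r ω) ∂PW + ∫ ω in S, (W r ω - W s ω) ∂PW := by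
      rw [← integral_add i1.integrableOn i2.integrableOn]
      congr 1
      ext ω
      ring
    rw [e, h1, zero_add]
    calc |∫ ω in S, (W r ω - W s ω) ∂PW| ≤ ∫ ω in S, |W r ω - W s ω| ∂PW :=
          abs_integral_le_integral_abs
      _ ≤ ∫ ω, |W r ω - W s ω| ∂PW :=
          setIntegral_le_integral i2.abs (Filter.Eventually.of_forall fun _ => abs_nonneg _)
      _ ≤ √(r - s) := bm_incr_abs hW hs hr1.le (hrt.trans ht)
      _ ≤ √(ε ^ 2) := Real.sqrt_le_sqrt hre
      _ = ε := Real.sqrt_sq hε.le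
  exact abs_nonpos_iff.1 (le_of_forall_pos_le_add fun ε hε => by simpa using key ε hε)

/-- Sets whose sections are a.e. measurable for the `ω₁`-dependent family `m`. -/
def secSA {ι : Type*} [Countable ι] (PΛ : Measure ΩΛ) (p : ι → ΩΛ → Prop)
    (m : ι → MeasurableSpace ΩW) : MeasurableSpace (ΩΛ × ΩW) where
  MeasurableSet' A := ∀ᵐ x ∂PΛ, ∀ i, p i x → MeasurableSet[m i] (Prod.mk x ⁻¹' A)
  measurableSet_empty := by simp
  measurableSet_compl A hA := by
    filter_upwards [hA] with x hx i hi
    exact (hx i hi).compl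
  measurableSet_iUnion f hf := by
    filter_upwards [ae_all_iff.2 hf] with x hx i hi
    rw [Set.preimage_iUnion]
    exact MeasurableSet.iUnion fun n => hx n i hi

theorem Hfilt_sec {PΛ : Measure ΩΛ} {PW : Measure ΩW} [IsProbabilityMeasure PΛ]
    [IsProbabilityMeasure PW] (W : ℝ → ΩW → ℝ) (Lam : ℝ → ΩΛ → ℝ) (T r : ℝ)
    {A : Set (ΩΛ × ΩW)} (hA : MeasurableSet[Hfilt (PΛ.prod PW) W Lam T r] A) :
    ∀ᵐ x ∂PΛ, MeasurableSet[eventuallyMeasurableSpace (histSA W r) (ae PW)]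
      (Prod.mk x ⁻¹' A) := by
  have hn : nullSA (PΛ.prod PW) ≤ secSA PΛ (fun (_ : Unit) _ => True)
      (fun _ => eventuallyMeasurableSpace (histSA W r) (ae PW)) := by
    refine MeasurableSpace.generateFrom_le fun s hs => ?_
    have := Measure.ae_ae_of_ae_prod (measure_eq_zero_iff_ae_notMem.1 hs)
    show ∀ᵐ x ∂PΛ, ∀ _ : Unit, True → _
    filter_upwards [this] with x hx _ _
    refine ⟨∅, @MeasurableSet.empty _ (histSA W r), ?_⟩
    exact Filter.eventuallyEq_empty.2 hx
  have hle : Hfilt (PΛ.prod PW) W Lam T r ≤ secSA PΛ (fun (_ : Unit) _ => True)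
      (fun _ => eventuallyMeasurableSpace (histSA W r) (ae PW)) := by
    refine sup_le (sup_le (iSup₂_le fun u hu => ?_) hn) (sup_le (iSup₂_le fun u hu => ?_) hn)
    · rintro _ ⟨B, hB, rfl⟩
      refine Filter.Eventually.of_forall fun x _ _ => ?_
      refine le_eventuallyMeasurableSpace _ ?_
      exact (le_iSup₂ (f := fun (u : ℝ) (_ : u ∈ Set.Icc (0 : ℝ) r) =>
        MeasurableSpace.comap (W u) inferInstance) u hu) _ ⟨B, hB, rfl⟩
    · rintro _ ⟨B, hB, rfl⟩
      refine Filter.Eventually.of_forall fun x _ _ => ?_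
      exact @MeasurableSet.const _ (_) (Lam u x ∈ B)
  filter_upwards [hle A hA] with x hx
  exact hx () trivial

theorem Hhat_sec {PΛ : Measure ΩΛ} {PW : Measure ΩW} [IsProbabilityMeasure PΛ]
    [IsProbabilityMeasure PW] (W : ℝ → ΩW → ℝ) (Lam : ℝ → ΩΛ → ℝ) (T R s : ℝ)
    {A : Set (ΩΛ × ΩW)} (hA : MeasurableSet[HhatSA (PΛ.prod PW) W Lam T R s] A) :
    ∀ᵐ x ∂PΛ, ∀ r : ℚ, (r : ℝ) ∈ Set.Icc 0 R ∧ Lam s x ≤ r →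
      MeasurableSet[eventuallyMeasurableSpace (histSA W r) (ae PW)] (Prod.mk x ⁻¹' A) := by
  have hle : HhatSA (PΛ.prod PW) W Lam T R s ≤ secSA PΛ
      (fun (r : ℚ) x => (r : ℝ) ∈ Set.Icc 0 R ∧ Lam s x ≤ r)
      (fun r => eventuallyMeasurableSpace (histSA W r) (ae PW)) := by
    refine MeasurableSpace.generateFrom_le fun A hA => ?_
    refine ae_all_iff.2 fun r => ?_
    by_cases hr : (r : ℝ) ∈ Set.Icc 0 R
    · filter_upwards [Hfilt_sec W Lam T r (hA.2 r hr)] with x hx h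
      have e : Prod.mk x ⁻¹' (A ∩ {ω | Lam s ω.1 ≤ r}) = Prod.mk x ⁻¹' A := by
        ext y
        simp [h.2]
      rwa [e] at hx
    · exact Filter.Eventually.of_forall fun x h => absurd h.1 hr
  exact hle A hA

theorem Hhat_null {P : Measure (ΩΛ × ΩW)} {PW : Measure ΩW} (T R : ℝ) {W : ℝ → ΩW → ℝ}
    {Lam : ℝ → ΩΛ → ℝ} (hW : IsBrownian PW R W) (hLam : IsTimeChange T R Lam) (s : ℝ)
    {A : Set (ΩΛ × ΩW)} (hA : MeasurableSet[HhatSA P W Lam T R s] A) :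
    NullMeasurableSet A P := by
  have hn : nullSA P ≤ eventuallyMeasurableSpace inferInstance (ae P) :=
    MeasurableSpace.generateFrom_le fun s hs => NullMeasurableSet.of_null hs
  have hle : HhatSA P W Lam T R s ≤ eventuallyMeasurableSpace inferInstance (ae P) := by
    refine MeasurableSpace.generateFrom_le fun A hA => ?_
    have : Hfilt P W Lam T R ≤ eventuallyMeasurableSpace inferInstance (ae P) := by
      refine sup_le (sup_le (iSup₂_le fun u hu => ?_) hn) (sup_le (iSup₂_le fun u hu => ?_) hn)
      · exact ((bm_meas hW u).comp measurable_snd).comap_le.trans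
          le_eventuallyMeasurableSpace
      · exact ((hLam.measurable u).comp measurable_fst).comap_le.trans
          le_eventuallyMeasurableSpace
    exact this A hA.1
  exact hle A hA

theorem tcBM_meas {PW : Measure ΩW} {T R : ℝ} {W : ℝ → ΩW → ℝ}
    {Lam : ℝ → ΩΛ → ℝ} (hW : IsBrownian PW R W) (hLam : IsTimeChange T R Lam) (t : ℝ) :
    Measurable (tcBM W Lam t) :=
  hW.measurable.comp (((hLam.measurable t).comp measurable_fst).prodMk measurable_snd)

theorem tcBM_integrable {PΛ : Measure ΩΛ} {PW : Measure ΩW} [IsProbabilityMeasure PΛ]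
    [IsProbabilityMeasure PW] {T R : ℝ} {W : ℝ → ΩW → ℝ}
    {Lam : ℝ → ΩΛ → ℝ} (hW : IsBrownian PW R W) (hLam : IsTimeChange T R Lam) {t : ℝ}
    (ht : t ∈ Set.Icc 0 T) : Integrable (tcBM W Lam t) (PΛ.prod PW) := by
  have hm := tcBM_meas hW hLam t
  rw [integrable_prod_iff hm.aestronglyMeasurable]
  constructor
  · refine Filter.Eventually.of_forall fun x => ?_
    have h := hLam.mem x t ht
    have := (bm_incr_memLp hW le_rfl h.1 h.2).integrable (by norm_num)
    simpa [hW.start, tcBM] using this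
  · refine Integrable.of_bound
      (hm.norm.stronglyMeasurable.integral_prod_right').aestronglyMeasurable (√R)
      (Filter.Eventually.of_forall fun x => ?_)
    have h := hLam.mem x t ht
    have h1 := bm_incr_abs hW le_rfl h.1 h.2
    rw [Real.norm_of_nonneg (integral_nonneg fun _ => norm_nonneg _)]
    simp only [hW.start, sub_zero] at h1
    exact h1.trans (Real.sqrt_le_sqrt h.2)

theorem liftW_stop_meas {P : Measure (ΩΛ × ΩW)} {PW : Measure ΩW} {T R : ℝ} {W : ℝ → ΩW → ℝ}
    {Lam : ℝ → ΩΛ → ℝ} (hW : IsBrownian PW R W) {t r : ℝ}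
    (ht : t ∈ Set.Icc 0 T) (hr : r ∈ Set.Icc 0 R) :
    Measurable[Hfilt P W Lam T r] (liftLam (ΩW := ΩW) Lam t) ∧
    Measurable[Hfilt P W Lam T r]
      (fun ω : ΩΛ × ΩW => W (max 0 (min (Lam t ω.1) r)) ω.2) := by
  have hL : Measurable[Hfilt P W Lam T r] (liftLam (ΩW := ΩW) Lam t) := by
    refine Measurable.of_comap_le (le_trans ?_ (le_sup_right.trans' le_sup_left))
    exact le_iSup₂ (f := fun (u : ℝ) (_ : u ∈ Set.Icc (0 : ℝ) T) =>
        MeasurableSpace.comap (liftLam (ΩW := ΩW) Lam u) inferInstance) t ht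
  refine ⟨hL, ?_⟩
  have hmem : ∀ x : ℝ, max 0 (min x r) ∈ Set.Icc 0 r := fun x =>
    ⟨le_max_left _ _, max_le hr.1 (min_le_right _ _)⟩
  have hWu : ∀ x : ℝ, Measurable[Hfilt P W Lam T r]
      (fun ω : ΩΛ × ΩW => W (max 0 (min x r)) ω.2) := by
    intro x
    refine Measurable.of_comap_le (le_trans ?_ (le_sup_left.trans' le_sup_left))
    exact le_iSup₂ (f := fun (u : ℝ) (_ : u ∈ Set.Icc (0 : ℝ) r) =>
        MeasurableSpace.comap (liftW (ΩΛ := ΩΛ) W u) inferInstance) _ (hmem x)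
  have hc : ∀ ω : ΩΛ × ΩW, Continuous fun x : ℝ => W (max 0 (min x r)) ω.2 := fun ω =>
    (hW.cont ω.2).comp_continuous (by fun_prop) fun x => ⟨(hmem x).1, (hmem x).2.trans hr.2⟩
  have hu := @measurable_uncurry_of_continuous_of_measurable _ _ _ _ _ _ _ _ _ _ _ _
    (Hfilt P W Lam T r) (fun (x : ℝ) (ω : ΩΛ × ΩW) => W (max 0 (min x r)) ω.2) hc hWu
  exact hu.comp (hL.prodMk measurable_id)

/-- `M = (W_{Λ_t})` is a martingale w.r.t. the time-changed enlarged filtration `Ĥ`: it is `Ĥ`-adapted, each `M_t` is integrable, and `E[M_t | Ĥ_s] = M_s` a.s. for `0 ≤ s ≤ t ≤ T`, expressed via equality of the set integrals over every `Ĥ_s`-measurable set. -/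
theorem timeChanged_BM_is_Hhat_martingale
    (T R : ℝ) (hT : 0 < T) (hR : 0 < R)
    (PΛ : Measure ΩΛ) (PW : Measure ΩW)
    [IsProbabilityMeasure PΛ] [IsProbabilityMeasure PW]
    (hcΛ : PΛ.IsComplete) (hcW : PW.IsComplete)
    (W : ℝ → ΩW → ℝ) (Lam : ℝ → ΩΛ → ℝ)
    (hW : IsBrownian PW R W) (hLam : IsTimeChange T R Lam)
    (P : Measure (ΩΛ × ΩW)) (hP : P = PΛ.prod PW)
    (hFLamT : natSA P (liftLam Lam) T
      = MeasurableSpace.comap (Prod.fst : ΩΛ × ΩW → ΩΛ) mΛ ⊔ nullSA P)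
    (hFWR : natSA P (liftW W) R
      = MeasurableSpace.comap (Prod.snd : ΩΛ × ΩW → ΩW) mW ⊔ nullSA P) :
    (∀ t ∈ Set.Icc (0 : ℝ) T, Measurable[HhatSA P W Lam T R t] (tcBM W Lam t)) ∧
    (∀ t ∈ Set.Icc (0 : ℝ) T, Integrable (tcBM W Lam t) P) ∧
    ∀ s t : ℝ, 0 ≤ s → s ≤ t → t ≤ T →
      ∀ A : Set (ΩΛ × ΩW), MeasurableSet[HhatSA P W Lam T R s] A →
        ∫ ω in A, tcBM W Lam t ω ∂P = ∫ ω in A, tcBM W Lam s ω ∂P := by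
  subst hP
  refine ⟨fun t ht => ?_, fun t ht => tcBM_integrable hW hLam ht, ?_⟩
  · intro B hB
    refine MeasurableSpace.measurableSet_generateFrom ?_
    have key : ∀ r ∈ Set.Icc (0 : ℝ) R, MeasurableSet[Hfilt (PΛ.prod PW) W Lam T r]
        (tcBM W Lam t ⁻¹' B ∩ {ω | Lam t ω.1 ≤ r}) := by
      intro r hr
      obtain ⟨h1, h2⟩ := liftW_stop_meas (P := PΛ.prod PW) (Lam := Lam) hW ht hr
      have e : tcBM W Lam t ⁻¹' B ∩ {ω : ΩΛ × ΩW | Lam t ω.1 ≤ r}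
          = (fun ω : ΩΛ × ΩW => W (max 0 (min (Lam t ω.1) r)) ω.2) ⁻¹' B
            ∩ liftLam Lam t ⁻¹' Set.Iic r := by
        ext ω
        have h0 := (hLam.mem ω.1 t ht).1
        simp only [Set.mem_inter_iff, Set.mem_preimage, Set.mem_ofPred_eq, Set.mem_Iic, tcBM,
          liftLam]
        refine and_congr_left fun h => ?_
        rw [min_eq_left h, max_eq_right h0]
      rw [e]
      exact (h2 hB).inter (h1 measurableSet_Iic)
    refine ⟨?_, key⟩
    have h := key R ⟨hR.le, le_rfl⟩
    have e : {ω : ΩΛ × ΩW | Lam t ω.1 ≤ R} = Set.univ :=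
      Set.eq_univ_of_forall fun ω => (hLam.mem ω.1 t ht).2
    rwa [e, Set.inter_univ] at h
  · intro s t hs hst ht A hA
    have hsT : s ∈ Set.Icc 0 T := ⟨hs, hst.trans ht⟩
    have htT : t ∈ Set.Icc 0 T := ⟨hs.trans hst, ht⟩
    have is := tcBM_integrable (PΛ := PΛ) hW hLam hsT
    have it := tcBM_integrable (PΛ := PΛ) hW hLam htT
    rw [← sub_eq_zero, ← integral_sub it.integrableOn is.integrableOn]
    obtain ⟨A', hA', hAA⟩ := Hhat_null T R hW hLam s hA
    rw [setIntegral_congr_set hAA, ← integral_indicator hA',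
      integral_prod (A'.indicator fun ω => tcBM W Lam t ω - tcBM W Lam s ω)
        ((it.sub is).indicator hA')]
    refine integral_eq_zero_of_ae ?_
    filter_upwards [Hhat_sec W Lam T R s hA, Measure.ae_ae_of_ae_prod hAA] with x hx hxA
    have e : (fun y => A'.indicator (fun ω => tcBM W Lam t ω - tcBM W Lam s ω) (x, y))
        = (Prod.mk x ⁻¹' A').indicator (fun y => W (Lam t x) y - W (Lam s x) y) := by
      ext y
      by_cases h : (x, y) ∈ A' <;> simp [Set.indicator, tcBM, h]
    rw [e, integral_indicator (measurable_prodMk_left hA')]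
    have hxA' : (Prod.mk x ⁻¹' A : Set ΩW) =ᵐ[PW] Prod.mk x ⁻¹' A' := hxA
    rw [← setIntegral_congr_set hxA']
    exact bm_incr_set' hW (hLam.mem x s hsT).1 (hLam.mono x hsT htT hst) (hLam.mem x t htT).2
      fun r hr hsr => hx r ⟨hr, hsr⟩


end
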